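/- arXiv:math/0409070 — 2 statements merged into one kernel-verified Lean document; each statement's English description precedes it below -/
import Mathlib

section
/- A formula F is derivable in LJ+ if and only if there exists a classically derivable propositional formula A such that A ⊃ F is derivable in LJ. -/
/-! Syntax of first-order formulas. Atoms are either propositional symbols
(arity-0) or predicate symbols of arity ≥ 1 applied to variables.
There are no function symbols or object constants: terms are variables (ℕ). -/

inductive Formula : Type
  | prop : ℕ → Formula                      -- propositional symbol
  | pred : ℕ → ℕ → List ℕ → Formula         -- predicate symbol (arity ≥ 1) applied to variables
  | top : Formula
  | bot : Formula
  | and : Formula → Formula → Formula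
  | or : Formula → Formula → Formula
  | imp : Formula → Formula → Formula
  | neg : Formula → Formula
  | all : ℕ → Formula → Formula             -- ∀x A
  | ex : ℕ → Formula → Formula              -- ∃x A
  deriving DecidableEq

namespace Formula

/-- Free variables of a formula. -/
def fv : Formula → Finset ℕ
  | prop _ => ∅
  | pred _ x xs => insert x xs.toFinset
  | top => ∅
  | bot => ∅
  | and A B => fv A ∪ fv B
  | or A B => fv A ∪ fv B
  | imp A B => fv A ∪ fv B
  | neg A => fv A
  | all x A => (fv A).erase x
  | ex x A => (fv A).erase x

/-- All variables occurring in a formula (free or bound, including binders). -/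
def vars : Formula → Finset ℕ
  | prop _ => ∅
  | pred _ x xs => insert x xs.toFinset
  | top => ∅
  | bot => ∅
  | and A B => vars A ∪ vars B
  | or A B => vars A ∪ vars B
  | imp A B => vars A ∪ vars B
  | neg A => vars A
  | all x A => insert x (vars A)
  | ex x A => insert x (vars A)

/-- Binder variables of a formula. -/
def bv : Formula → Finset ℕ
  | prop _ => ∅
  | pred _ _ _ => ∅
  | top => ∅
  | bot => ∅
  | and A B => bv A ∪ bv B
  | or A B => bv A ∪ bv B
  | imp A B => bv A ∪ bv B
  | neg A => bv A
  | all x A => insert x (bv A)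
  | ex x A => insert x (bv A)

/-- `rename a b F` replaces the free occurrences of variable `a` in `F` by variable `b`.
`F.rename a b` plays the role of "F(b)" when `F` is "F(a)". -/
def rename (a b : ℕ) : Formula → Formula
  | prop n => prop n
  | pred n x xs =>
      pred n (if x = a then b else x) (xs.map fun y => if y = a then b else y)
  | top => top
  | bot => bot
  | and A B => and (rename a b A) (rename a b B)
  | or A B => or (rename a b A) (rename a b B)
  | imp A B => imp (rename a b A) (rename a b B)
  | neg A => neg (rename a b A)
  | all x A => if x = a then all x A else all x (rename a b A)
  | ex x A => if x = a then ex x A else ex x (rename a b A)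

/-- A formula is propositional if it is built from propositional symbols (and ⊤, ⊥)
by the propositional connectives only. -/
def Propositional : Formula → Prop
  | prop _ => True
  | pred _ _ _ => False
  | top => True
  | bot => True
  | and A B => Propositional A ∧ Propositional B
  | or A B => Propositional A ∧ Propositional B
  | imp A B => Propositional A ∧ Propositional B
  | neg A => Propositional A
  | all _ _ => False
  | ex _ _ => False

/-- A formula is purely predicate if all its atoms are built from predicate symbols
of arity > 0 (it contains no propositional symbols). -/
def PurelyPredicate : Formula → Prop
  | prop _ => False
  | pred _ _ _ => True
  | top => True
  | bot => True
  | and A B => PurelyPredicate A ∧ PurelyPredicate B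
  | or A B => PurelyPredicate A ∧ PurelyPredicate B
  | imp A B => PurelyPredicate A ∧ PurelyPredicate B
  | neg A => PurelyPredicate A
  | all _ A => PurelyPredicate A
  | ex _ A => PurelyPredicate A

/-- Truth-table evaluation of a propositional formula under assignment `v`. -/
def evalP (v : ℕ → Bool) : Formula → Bool
  | prop n => v n
  | pred _ _ _ => false
  | top => true
  | bot => false
  | and A B => evalP v A && evalP v B
  | or A B => evalP v A || evalP v B
  | imp A B => !evalP v A || evalP v B
  | neg A => !evalP v A
  | all _ _ => false
  | ex _ _ => false

/-- A (propositional) formula is classically valid / derivable in classical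
propositional logic if it is true under every truth-value assignment. -/
def ClassicallyValid (A : Formula) : Prop := ∀ v : ℕ → Bool, evalP v A = true

/-- `substProp R C A` replaces all occurrences of the propositional symbol `R`
in `A` by the formula `C` (written A{R|C} in the paper). -/
def substProp (R : ℕ) (C : Formula) : Formula → Formula
  | prop n => if n = R then C else prop n
  | pred n x xs => pred n x xs
  | top => top
  | bot => bot
  | and A B => and (substProp R C A) (substProp R C B)
  | or A B => or (substProp R C A) (substProp R C B)
  | imp A B => imp (substProp R C A) (substProp R C B)
  | neg A => neg (substProp R C A)
  | all x A => all x (substProp R C A)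
  | ex x A => ex x (substProp R C A)

/-- `polProps b F` is the set of propositional symbols having an occurrence of
polarity `b` in `F` (`true` = positive, `false` = negative); `F` itself is a
positive occurrence, ∨ & quantifiers preserve polarity, ¬ flips it, and
`A ⊃ B` flips the polarity of `A` and preserves that of `B`. -/
def polProps : Bool → Formula → Finset ℕ
  | b, prop n => if b then {n} else ∅
  | _, pred _ _ _ => ∅
  | _, top => ∅
  | _, bot => ∅
  | b, and A B => polProps b A ∪ polProps b B
  | b, or A B => polProps b A ∪ polProps b B
  | b, imp A B => polProps (!b) A ∪ polProps b B
  | b, neg A => polProps (!b) A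
  | b, all _ A => polProps b A
  | b, ex _ A => polProps b A

/-- The propositional symbols occurring in a formula. -/
def propSyms (F : Formula) : Finset ℕ := polProps true F ∪ polProps false F

/-- A formula is unipolar if the occurrences of every propositional symbol in it
are either all positive or all negative. -/
def Unipolar (F : Formula) : Prop :=
  ∀ n : ℕ, ¬ (n ∈ polProps true F ∧ n ∈ polProps false F)

end Formula

/-- A sequent Γ ⊢ Λ: the antecedent is a finite sequence of formulas and the
succedent contains at most one formula. -/
abbrev Sequent := List Formula × Option Formula

/-- Free variables of a list of formulas. -/
def fvList (Γ : List Formula) : Finset ℕ := Γ.foldr (fun A s => A.fv ∪ s) ∅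

/-- Free variables of an optional succedent formula. -/
def fvOpt : Option Formula → Finset ℕ
  | none => ∅
  | some A => A.fv

/-- Inference rules (conclusion, list of premises) of Gentzen-style sequent calculi.
The flag `cut` enables the cut rule, the flag `neut` enables the neutralization
rule (restricted to propositional formulas `N`), and `lem` determines the class of
formulas `A` for which the axiom `⊢ A ∨ ¬A` is available. -/
inductive Rule (cut neut : Bool) (lem : Formula → Prop) : Sequent → List Sequent → Prop
  | ax (A : Formula) : Rule cut neut lem ([A], some A) []
  | topR : Rule cut neut lem ([], some .top) []
  | botL : Rule cut neut lem ([.bot], none) []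
  | thinL (A : Formula) (Γ : List Formula) (Λ : Option Formula) :
      Rule cut neut lem (A :: Γ, Λ) [(Γ, Λ)]
  | thinR (A : Formula) (Γ : List Formula) :
      Rule cut neut lem (Γ, some A) [(Γ, none)]
  | contr (A : Formula) (Γ : List Formula) (Λ : Option Formula) :
      Rule cut neut lem (A :: Γ, Λ) [(A :: A :: Γ, Λ)]
  | exch (Δ Γ : List Formula) (A B : Formula) (Λ : Option Formula) :
      Rule cut neut lem (Δ ++ B :: A :: Γ, Λ) [(Δ ++ A :: B :: Γ, Λ)]
  | cut' (Γ Δ : List Formula) (C : Formula) (Λ : Option Formula) (hc : cut = true) :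
      Rule cut neut lem (Γ ++ Δ, Λ) [(Γ, some C), (C :: Δ, Λ)]
  | andR (Γ : List Formula) (A B : Formula) :
      Rule cut neut lem (Γ, some (A.and B)) [(Γ, some A), (Γ, some B)]
  | andL1 (A B : Formula) (Γ : List Formula) (Λ : Option Formula) :
      Rule cut neut lem (A.and B :: Γ, Λ) [(A :: Γ, Λ)]
  | andL2 (A B : Formula) (Γ : List Formula) (Λ : Option Formula) :
      Rule cut neut lem (A.and B :: Γ, Λ) [(B :: Γ, Λ)]
  | orL (A B : Formula) (Γ : List Formula) (Λ : Option Formula) :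
      Rule cut neut lem (A.or B :: Γ, Λ) [(A :: Γ, Λ), (B :: Γ, Λ)]
  | orR1 (Γ : List Formula) (A B : Formula) :
      Rule cut neut lem (Γ, some (A.or B)) [(Γ, some A)]
  | orR2 (Γ : List Formula) (A B : Formula) :
      Rule cut neut lem (Γ, some (A.or B)) [(Γ, some B)]
  | negR (A : Formula) (Γ : List Formula) :
      Rule cut neut lem (Γ, some A.neg) [(A :: Γ, none)]
  | negL (A : Formula) (Γ : List Formula) :
      Rule cut neut lem (A.neg :: Γ, none) [(Γ, some A)]
  | impR (A B : Formula) (Γ : List Formula) :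
      Rule cut neut lem (Γ, some (A.imp B)) [(A :: Γ, some B)]
  | impL (A B : Formula) (Γ Δ : List Formula) (Λ : Option Formula) :
      Rule cut neut lem (A.imp B :: (Γ ++ Δ), Λ) [(Γ, some A), (B :: Δ, Λ)]
  | allR (Γ : List Formula) (x a : ℕ) (G : Formula)
      (ha : a ∉ fvList Γ ∪ (Formula.all x G).fv) (hv : a ∉ G.vars) :
      Rule cut neut lem (Γ, some (.all x G)) [(Γ, some (G.rename x a))]
  | allL (x : ℕ) (G : Formula) (a : ℕ) (Γ : List Formula) (Λ : Option Formula)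
      (hc : a = x ∨ a ∉ G.bv) :
      Rule cut neut lem (.all x G :: Γ, Λ) [(G.rename x a :: Γ, Λ)]
  | exR (Γ : List Formula) (x : ℕ) (G : Formula) (a : ℕ)
      (hc : a = x ∨ a ∉ G.bv) :
      Rule cut neut lem (Γ, some (.ex x G)) [(Γ, some (G.rename x a))]
  | exL (x : ℕ) (G : Formula) (a : ℕ) (Γ : List Formula) (Λ : Option Formula)
      (ha : a ∉ (fvList Γ ∪ (Formula.ex x G).fv) ∪ fvOpt Λ) (hv : a ∉ G.vars) :
      Rule cut neut lem (.ex x G :: Γ, Λ) [(G.rename x a :: Γ, Λ)]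
  | neut' (N : Formula) (Γ : List Formula) (Λ : Option Formula)
      (hn : neut = true) (hN : N.Propositional) :
      Rule cut neut lem (Γ, Λ) [(N :: Γ, Λ), (N.neg :: Γ, Λ)]
  | lemAx (A : Formula) (h : lem A) :
      Rule cut neut lem ([], some (A.or A.neg)) []

/-- Derivability from a set of rules. -/
inductive Derives (R : Sequent → List Sequent → Prop) : Sequent → Prop
  | step {s : Sequent} {ps : List Sequent} :
      R s ps → (∀ p ∈ ps, Derives R p) → Derives R s

/-- No additional excluded-middle axioms. -/
def NoLem : Formula → Prop := fun _ => False

/-- LJ: Gentzen's intuitionistic sequent calculus. -/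
def LJ : Sequent → Prop := Derives (Rule true false NoLem)

/-- LJ+: LJ extended with the neutralization rule. -/
def LJPlus : Sequent → Prop := Derives (Rule true true NoLem)

/-- Cut-free LJ+. -/
def LJPlusCF : Sequent → Prop := Derives (Rule false true NoLem)

/-- LJ extended with the axiom schema ⊢ A ∨ ¬A for every propositional symbol A. -/
def LJLemPropAtoms : Sequent → Prop :=
  Derives (Rule true false (fun A => ∃ n : ℕ, A = Formula.prop n))

/-- LK: Gentzen's classical sequent calculus, presented equivalently as
LJ plus the axiom schema ⊢ A ∨ ¬A for arbitrary formulas A. -/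
def LK : Sequent → Prop := Derives (Rule true false (fun _ => True))

/-- A formula is a theorem of LJ+ if the sequent ⊢ F is derivable. -/
def LJPlusThm (F : Formula) : Prop := LJPlus ([], some F)

def LJThm (F : Formula) : Prop := LJ ([], some F)

def LKThm (F : Formula) : Prop := LK ([], some F)

/-- Intuitionistic Kripke structures: a partially ordered set of nodes with
monotone nonempty domains and monotone valuations for propositional symbols
and for predicate symbols. -/
structure Kripke where
  W : Type
  U : Type
  le : W → W → Prop
  le_refl : ∀ w, le w w
  le_trans : ∀ u v w, le u v → le v w → le u w
  le_antisymm : ∀ u v, le u v → le v u → u = v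
  D : W → Set U
  D_ne : ∀ w, (D w).Nonempty
  D_mono : ∀ {w w'}, le w w' → D w ⊆ D w'
  TP : W → ℕ → Prop
  TQ : W → ℕ → List U → Prop
  TP_mono : ∀ {w w'}, le w w' → ∀ n, TP w n → TP w' n
  TQ_mono : ∀ {w w'}, le w w' → ∀ n ds, TQ w n ds → TQ w' n ds

/-- A constrained Kripke structure: for all nodes k ≤ k' and every propositional
symbol Q, Q is in the valuation of k if and only if it is in the valuation of k'. -/
def Kripke.Constrained (K : Kripke) : Prop :=
  ∀ {w w' : K.W}, K.le w w' → ∀ n : ℕ, (K.TP w n ↔ K.TP w' n)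

/-- The standard intuitionistic forcing relation (with an assignment σ of
domain elements to variables). -/
def Kripke.forces (K : Kripke) : K.W → (ℕ → K.U) → Formula → Prop
  | w, _, .prop n => K.TP w n
  | w, σ, .pred n x xs => K.TQ w n ((x :: xs).map σ)
  | _, _, .top => True
  | _, _, .bot => False
  | w, σ, .and A B => K.forces w σ A ∧ K.forces w σ B
  | w, σ, .or A B => K.forces w σ A ∨ K.forces w σ B
  | w, σ, .imp A B => ∀ w', K.le w w' → K.forces w' σ A → K.forces w' σ B
  | w, σ, .neg A => ∀ w', K.le w w' → ¬ K.forces w' σ A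
  | w, σ, .all x A => ∀ w', K.le w w' → ∀ d ∈ K.D w', K.forces w' (Function.update σ x d) A
  | w, σ, .ex x A => ∃ d ∈ K.D w, K.forces w (Function.update σ x d) A

/-- Validity of a sequent with respect to constrained Kripke structures:
at every node of every constrained Kripke structure (under every assignment into
the node's domain), either some antecedent formula is not forced, or the
succedent is nonempty and its formula is forced. -/
def SeqValid (s : Sequent) : Prop :=
  ∀ K : Kripke, K.Constrained → ∀ w : K.W, ∀ σ : ℕ → K.U, (∀ n, σ n ∈ K.D w) →
    (∃ A ∈ s.1, ¬ K.forces w σ A) ∨ (∃ A, s.2 = some A ∧ K.forces w σ A)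

namespace Formula

@[simp] theorem propSyms_neg (A : Formula) : A.neg.propSyms = A.propSyms :=
  Finset.union_comm _ _

@[simp] theorem propSyms_and (A B : Formula) :
    (A.and B).propSyms = A.propSyms ∪ B.propSyms :=
  Finset.union_union_union_comm _ _ _ _

@[simp] theorem propSyms_or (A B : Formula) :
    (A.or B).propSyms = A.propSyms ∪ B.propSyms :=
  Finset.union_union_union_comm _ _ _ _

@[simp] theorem propSyms_imp (A B : Formula) :
    (A.imp B).propSyms = A.propSyms ∪ B.propSyms :=
  (Finset.union_union_union_comm _ _ _ _).trans
    (congrArg (· ∪ B.propSyms) (Finset.union_comm _ _))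

theorem Propositional.fv_eq_empty {A : Formula} (hA : A.Propositional) : A.fv = ∅ := by
  induction A with
  | pred | all | ex => exact hA.elim
  | prop | top | bot => rfl
  | neg A ih => exact ih hA
  | and A B ihA ihB | or A B ihA ihB | imp A B ihA ihB =>
    simp [Formula.fv, ihA hA.1, ihB hA.2]

end Formula

namespace Derives

variable {c b : Bool} {lem : Formula → Prop} {Γ Γ' : List Formula} {Λ : Option Formula}
  {A B : Formula}

theorem of_rule₀ {R : Sequent → List Sequent → Prop} {s : Sequent} (h : R s []) : Derives R s :=
  .step h (by simp)

theorem of_rule₁ {R : Sequent → List Sequent → Prop} {s p : Sequent} (h : R s [p])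
    (hp : Derives R p) : Derives R s :=
  .step h (by simpa using hp)

theorem of_rule₂ {R : Sequent → List Sequent → Prop} {s p q : Sequent} (h : R s [p, q])
    (hp : Derives R p) (hq : Derives R q) : Derives R s :=
  .step h (by simpa using ⟨hp, hq⟩)

theorem mono {R R' : Sequent → List Sequent → Prop} (hR : ∀ s ps, R s ps → R' s ps)
    {s : Sequent} (h : Derives R s) : Derives R' s := by
  induction h with
  | step hr _ ih => exact .step (hR _ _ hr) ih

theorem perm_append (hp : Γ.Perm Γ') (Δ : List Formula)
    (h : Derives (Rule c b lem) (Δ ++ Γ, Λ)) : Derives (Rule c b lem) (Δ ++ Γ', Λ) := by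
  induction hp generalizing Δ with
  | nil => exact h
  | cons a _ ih => simpa using ih (Δ ++ [a]) (by simpa using h)
  | swap x y l => exact of_rule₁ (.exch Δ l y x Λ) h
  | trans _ _ ih₁ ih₂ => exact ih₂ Δ (ih₁ Δ h)

theorem perm (hp : Γ.Perm Γ') (h : Derives (Rule c b lem) (Γ, Λ)) :
    Derives (Rule c b lem) (Γ', Λ) :=
  perm_append hp [] h

theorem thin_append (Δ : List Formula) (h : Derives (Rule c b lem) (Γ, Λ)) :
    Derives (Rule c b lem) (Δ ++ Γ, Λ) := by
  induction Δ with
  | nil => exact h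
  | cons a Δ ih => exact of_rule₁ (.thinL a _ Λ) ih

theorem contract_append {Δ : List Formula} (hs : Δ ⊆ Γ)
    (h : Derives (Rule c b lem) (Δ ++ Γ, Λ)) : Derives (Rule c b lem) (Γ, Λ) := by
  induction Δ with
  | nil => exact h
  | cons a Δ ih =>
    have ha : a ∈ Γ := hs (by simp)
    have hp : (Δ ++ Γ).Perm (a :: (Δ ++ Γ.erase a)) :=
      ((List.perm_cons_erase ha).append_left Δ).trans List.perm_middle
    exact ih (fun x hx => hs (by simp [hx]))
      (perm hp.symm (of_rule₁ (.contr a _ Λ) (perm (hp.cons a) h)))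

/-- Derivability is monotone in the set of antecedent formulas. -/
theorem weaken (hs : Γ ⊆ Γ') (h : Derives (Rule c b lem) (Γ, Λ)) :
    Derives (Rule c b lem) (Γ', Λ) :=
  contract_append hs (perm List.perm_append_comm (thin_append Γ' h))

theorem of_mem (h : A ∈ Γ) : Derives (Rule c b lem) (Γ, some A) :=
  weaken (by simpa using h) (of_rule₀ (.ax A))

theorem cut_shared (h : Derives (Rule true b lem) (Γ, some A))
    (h' : Derives (Rule true b lem) (A :: Γ, Λ)) : Derives (Rule true b lem) (Γ, Λ) :=
  weaken (by simp) (of_rule₂ (.cut' Γ Γ A Λ rfl) h h')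

theorem none_of_neg (hn : Derives (Rule true b lem) (Γ, some A.neg))
    (h : Derives (Rule true b lem) (Γ, some A)) : Derives (Rule true b lem) (Γ, none) :=
  cut_shared hn (of_rule₁ (.negL A Γ) h)

/-- An antecedent that decides every propositional symbol of `A` derives `A` or its negation,
according to the truth value of `A`. -/
theorem decide_propositional (hA : A.Propositional) {v : ℕ → Bool}
    (hv : ∀ n ∈ A.propSyms,
      (v n = true ∧ Formula.prop n ∈ Γ) ∨ (v n = false ∧ (Formula.prop n).neg ∈ Γ)) :
    (A.evalP v = true → Derives (Rule true b lem) (Γ, some A)) ∧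
      (A.evalP v = false → Derives (Rule true b lem) (Γ, some A.neg)) := by
  induction A with
  | prop n =>
    have := hv n (by simp [Formula.propSyms, Formula.polProps])
    simp only [Formula.evalP]
    refine ⟨fun h => of_mem ?_, fun h => of_mem ?_⟩ <;> simp_all
  | pred | all | ex => exact hA.elim
  | top =>
    exact ⟨fun _ => weaken (by simp) (of_rule₀ .topR), by simp [Formula.evalP]⟩
  | bot =>
    exact ⟨by simp [Formula.evalP],
      fun _ => of_rule₁ (.negR _ _) (weaken (by simp) (of_rule₀ .botL))⟩
  | neg A ih =>
    obtain ⟨ht, hf⟩ := ih hA fun n hn => hv n (by simp [hn])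
    simp only [Formula.evalP, Bool.not_eq_true', Bool.not_eq_false']
    exact ⟨hf, fun h => of_rule₁ (.negR _ _) (of_rule₁ (.negL _ _) (ht h))⟩
  | and A B ihA ihB =>
    obtain ⟨htA, hfA⟩ := ihA hA.1 fun n hn => hv n (by simp [hn])
    obtain ⟨htB, hfB⟩ := ihB hA.2 fun n hn => hv n (by simp [hn])
    simp only [Formula.evalP, Bool.and_eq_true, Bool.and_eq_false_iff]
    refine ⟨fun h => of_rule₂ (.andR _ _ _) (htA h.1) (htB h.2),
      fun h => of_rule₁ (.negR _ _) ?_⟩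
    rcases h with h | h
    · exact of_rule₁ (.andL1 _ _ _ _)
        (none_of_neg (weaken (by simp) (hfA h)) (of_mem (by simp)))
    · exact of_rule₁ (.andL2 _ _ _ _)
        (none_of_neg (weaken (by simp) (hfB h)) (of_mem (by simp)))
  | or A B ihA ihB =>
    obtain ⟨htA, hfA⟩ := ihA hA.1 fun n hn => hv n (by simp [hn])
    obtain ⟨htB, hfB⟩ := ihB hA.2 fun n hn => hv n (by simp [hn])
    simp only [Formula.evalP, Bool.or_eq_true, Bool.or_eq_false_iff]
    refine ⟨fun h => ?_, fun h => of_rule₁ (.negR _ _) (of_rule₂ (.orL _ _ _ _)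
      (none_of_neg (weaken (by simp) (hfA h.1)) (of_mem (by simp)))
      (none_of_neg (weaken (by simp) (hfB h.2)) (of_mem (by simp))))⟩
    rcases h with h | h
    · exact of_rule₁ (.orR1 _ _ _) (htA h)
    · exact of_rule₁ (.orR2 _ _ _) (htB h)
  | imp A B ihA ihB =>
    obtain ⟨htA, hfA⟩ := ihA hA.1 fun n hn => hv n (by simp [hn])
    obtain ⟨htB, hfB⟩ := ihB hA.2 fun n hn => hv n (by simp [hn])
    simp only [Formula.evalP, Bool.or_eq_true, Bool.or_eq_false_iff, Bool.not_eq_true',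
      Bool.not_eq_false']
    refine ⟨fun h => of_rule₁ (.impR _ _ _) ?_, fun h => of_rule₁ (.negR _ _) ?_⟩
    · rcases h with h | h
      · exact of_rule₁ (.thinR _ _)
          (none_of_neg (weaken (by simp) (hfA h)) (of_mem (by simp)))
      · exact weaken (by simp) (htB h)
    · exact weaken (by simp) (of_rule₂ (.impL A B Γ Γ none) (htA h.1)
        (none_of_neg (weaken (by simp) (hfB h.2)) (of_mem (by simp))))

/-- Neutralization on propositional symbols derives every classically valid formula. -/
theorem of_classicallyValid (hA : A.Propositional) (hv : A.ClassicallyValid) (l : List ℕ)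
    (hl : ∀ n ∈ A.propSyms, n ∈ l ∨ Formula.prop n ∈ Γ ∨ (Formula.prop n).neg ∈ Γ) :
    Derives (Rule true true lem) (Γ, some A) := by
  induction l generalizing Γ with
  | nil =>
    refine (decide_propositional hA (v := fun n => decide (Formula.prop n ∈ Γ))
      fun n hn => ?_).1 (hv _)
    have := hl n hn
    by_cases h : Formula.prop n ∈ Γ <;> simp_all
  | cons m l ih =>
    refine of_rule₂ (.neut' (.prop m) Γ _ rfl trivial) (ih fun n hn => ?_) (ih fun n hn => ?_)
    all_goals
      have := hl n hn
      simp only [List.mem_cons, Formula.prop.injEq, Formula.neg.injEq] at this ⊢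
      tauto

end Derives

theorem LJ.ljPlus {s : Sequent} (h : LJ s) : LJPlus s := by
  refine Derives.mono (fun s ps hr => ?_) h
  cases hr <;> first | (constructor <;> assumption) | contradiction

/-- Derivability in LJ from an additional classically valid propositional antecedent. -/
def LJFromClassical (s : Sequent) : Prop :=
  ∃ A : Formula, A.Propositional ∧ A.ClassicallyValid ∧ LJ (A :: s.1, s.2)

namespace LJFromClassical

open Derives

theorem of_lj {s : Sequent} (h : LJ s) : LJFromClassical s :=
  ⟨.top, trivial, fun _ => rfl, of_rule₁ (.thinL _ _ _) h⟩

theorem common {s t : Sequent} (hs : LJFromClassical s) (ht : LJFromClassical t) :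
    ∃ A : Formula, A.Propositional ∧ A.ClassicallyValid ∧
      LJ (A :: s.1, s.2) ∧ LJ (A :: t.1, t.2) := by
  obtain ⟨A, hA, hvA, hs⟩ := hs
  obtain ⟨B, hB, hvB, ht⟩ := ht
  exact ⟨A.and B, ⟨hA, hB⟩, fun v => by simp [Formula.evalP, hvA v, hvB v],
    of_rule₁ (.andL1 _ _ _ _) hs, of_rule₁ (.andL2 _ _ _ _) ht⟩

theorem map₁ {s t : Sequent} (hs : LJFromClassical s)
    (f : ∀ A : Formula, A.fv = ∅ → LJ (A :: s.1, s.2) → LJ (A :: t.1, t.2)) :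
    LJFromClassical t := by
  obtain ⟨A, hA, hv, h⟩ := hs
  exact ⟨A, hA, hv, f A hA.fv_eq_empty h⟩

theorem map₂ {s s' t : Sequent} (hs : LJFromClassical s) (hs' : LJFromClassical s')
    (f : ∀ A : Formula, LJ (A :: s.1, s.2) → LJ (A :: s'.1, s'.2) → LJ (A :: t.1, t.2)) :
    LJFromClassical t := by
  obtain ⟨A, hA, hv, h, h'⟩ := common hs hs'
  exact ⟨A, hA, hv, f A h h'⟩

theorem swap {A B : Formula} {Γ : List Formula} {Λ : Option Formula}
    (h : LJ (A :: B :: Γ, Λ)) : LJ (B :: A :: Γ, Λ) :=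
  of_rule₁ (.exch [] Γ A B Λ) h

theorem neutralize {N : Formula} {Γ : List Formula} {Λ : Option Formula} (hN : N.Propositional)
    (h : LJFromClassical (N :: Γ, Λ)) (h' : LJFromClassical (N.neg :: Γ, Λ)) :
    LJFromClassical (Γ, Λ) := by
  obtain ⟨A, hA, hv, h, h'⟩ := common h h'
  refine ⟨A.and (N.or N.neg), ⟨hA, hN, hN⟩, fun v => by simp [Formula.evalP, hv v], ?_⟩
  refine of_rule₁ (.contr _ _ _) (of_rule₁ (.andL1 _ _ _ _)
    (swap (of_rule₁ (.andL2 _ _ _ _) (of_rule₂ (.orL _ _ _ _) (swap h) (swap h')))))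

theorem of_ljPlus {s : Sequent} (h : LJPlus s) : LJFromClassical s := by
  induction h with
  | step hr _ ih =>
    cases hr with
    | ax A => exact of_lj (of_rule₀ (.ax A))
    | topR => exact of_lj (of_rule₀ .topR)
    | botL => exact of_lj (of_rule₀ .botL)
    | lemAx A h => exact h.elim
    | neut' N Γ Λ _ hN => exact neutralize hN (ih _ (by simp)) (ih _ (by simp))
    | thinL A Γ Λ => exact (ih _ List.mem_cons_self).map₁ fun C _ h => swap (of_rule₁ (.thinL A _ _) h)
    | thinR A Γ => exact (ih _ List.mem_cons_self).map₁ fun C _ h => of_rule₁ (.thinR A _) h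
    | contr A Γ Λ => exact (ih _ List.mem_cons_self).map₁ fun C _ h => weaken (by simp) h
    | exch Δ Γ A B Λ =>
      exact (ih _ List.mem_cons_self).map₁ fun C _ h => of_rule₁ (.exch (C :: Δ) Γ A B Λ) h
    | cut' Γ Δ C Λ hc =>
      exact (ih (Γ, some C) (by simp)).map₂ (ih (C :: Δ, Λ) (by simp)) fun E h h' =>
        weaken (fun D hD => by simp at hD ⊢; tauto) (of_rule₂ (.cut' (E :: Γ) (E :: Δ) C Λ rfl) h (swap h'))
    | andR Γ A B =>
      exact (ih (Γ, some A) (by simp)).map₂ (ih (Γ, some B) (by simp)) fun C h h' =>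
        of_rule₂ (.andR _ A B) h h'
    | andL1 A B Γ Λ =>
      exact (ih _ List.mem_cons_self).map₁ fun C _ h => swap (of_rule₁ (.andL1 A B _ Λ) (swap h))
    | andL2 A B Γ Λ =>
      exact (ih _ List.mem_cons_self).map₁ fun C _ h => swap (of_rule₁ (.andL2 A B _ Λ) (swap h))
    | orL A B Γ Λ =>
      exact (ih (A :: Γ, Λ) (by simp)).map₂ (ih (B :: Γ, Λ) (by simp)) fun C h h' =>
        swap (of_rule₂ (.orL A B _ Λ) (swap h) (swap h'))
    | orR1 Γ A B => exact (ih _ List.mem_cons_self).map₁ fun C _ h => of_rule₁ (.orR1 _ A B) h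
    | orR2 Γ A B => exact (ih _ List.mem_cons_self).map₁ fun C _ h => of_rule₁ (.orR2 _ A B) h
    | negR A Γ => exact (ih _ List.mem_cons_self).map₁ fun C _ h => of_rule₁ (.negR A _) (swap h)
    | negL A Γ => exact (ih _ List.mem_cons_self).map₁ fun C _ h => swap (of_rule₁ (.negL A _) h)
    | impR A B Γ => exact (ih _ List.mem_cons_self).map₁ fun C _ h => of_rule₁ (.impR A B _) (swap h)
    | impL A B Γ Δ Λ =>
      exact (ih (Γ, some A) (by simp)).map₂ (ih (B :: Δ, Λ) (by simp)) fun C h h' =>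
        weaken (fun D hD => by simp at hD ⊢; tauto) (of_rule₂ (.impL A B (C :: Γ) (C :: Δ) Λ) h (swap h'))
    | allR Γ x a G ha hv =>
      exact (ih _ List.mem_cons_self).map₁ fun C hC h =>
        of_rule₁ (.allR _ x a G (by simpa [fvList, hC] using ha) hv) h
    | allL x G a Γ Λ hc =>
      exact (ih _ List.mem_cons_self).map₁ fun C _ h => swap (of_rule₁ (.allL x G a _ Λ hc) (swap h))
    | exR Γ x G a hc =>
      exact (ih _ List.mem_cons_self).map₁ fun C _ h => of_rule₁ (.exR _ x G a hc) h
    | exL x G a Γ Λ ha hv =>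
      exact (ih _ List.mem_cons_self).map₁ fun C hC h =>
        swap (of_rule₁ (.exL x G a _ Λ (by simpa [fvList, hC] using ha) hv) (swap h))

end LJFromClassical

/-- F is derivable in LJ+ iff there is a classically derivable
propositional formula A such that A ⊃ F is derivable in LJ. -/
theorem ljplus_iff_classical_prop_hyp (F : Formula) :
    LJPlusThm F ↔
      ∃ A : Formula, A.Propositional ∧ A.ClassicallyValid ∧ LJThm (A.imp F) := by
  constructor
  · intro h
    obtain ⟨A, hA, hv, h⟩ := LJFromClassical.of_ljPlus h
    exact ⟨A, hA, hv, Derives.of_rule₁ (.impR A F []) h⟩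
  · rintro ⟨A, hA, hv, h⟩
    have hA' : LJPlus ([], some A) :=
      Derives.of_classicallyValid hA hv A.propSyms.toList fun n hn => .inl (by simpa using hn)
    exact Derives.cut_shared h.ljPlus
      (Derives.of_rule₂ (.impL A F [] [] (some F)) hA' (Derives.of_mem (by simp)))
end

section
/- For a unary predicate symbol P, the formula ∃x P(x) ∨ ¬∃x P(x) is not derivable in LJ+ (although it is derivable in classical logic LK). -/
namespace Formula

variable {H : Type*} [HeytingAlgebra H]

/-- Evaluation of formulas in a Heyting algebra over a one-element domain: quantifiers are
vacuous, and `v`, `q` interpret the propositional and predicate symbols. -/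
def heytingEval (v q : ℕ → H) : Formula → H
  | prop n => v n
  | pred n _ _ => q n
  | top => ⊤
  | bot => ⊥
  | and A B => heytingEval v q A ⊓ heytingEval v q B
  | or A B => heytingEval v q A ⊔ heytingEval v q B
  | imp A B => heytingEval v q A ⇨ heytingEval v q B
  | neg A => (heytingEval v q A)ᶜ
  | all _ A => heytingEval v q A
  | ex _ A => heytingEval v q A

@[simp]
theorem heytingEval_rename (v q : ℕ → H) (a b : ℕ) (A : Formula) :
    (A.rename a b).heytingEval v q = A.heytingEval v q := by
  induction A <;> simp only [rename] <;> (try split_ifs) <;> simp_all [heytingEval]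

theorem Propositional.heytingEval_sup_compl {v : ℕ → H} (q : ℕ → H)
    (hv : ∀ n, v n ⊔ (v n)ᶜ = ⊤) {A : Formula} (hA : A.Propositional) :
    A.heytingEval v q ⊔ (A.heytingEval v q)ᶜ = ⊤ := by
  have key : IsComplemented (A.heytingEval v q) := by
    have hc : ∀ a : H, a ⊔ aᶜ = ⊤ → IsComplemented a := fun a h =>
      ⟨aᶜ, disjoint_compl_right, codisjoint_iff.2 h⟩
    induction A with
    | prop n => exact hc _ (hv n)
    | top => exact isComplemented_top
    | bot => exact isComplemented_bot
    | and A B ihA ihB => exact (ihA hA.1).inf (ihB hA.2)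
    | or A B ihA ihB => exact (ihA hA.1).sup (ihB hA.2)
    | imp A B ihA ihB =>
      obtain ⟨a, ha⟩ := ihA hA.1
      have hB := ihB hA.2
      have : (imp A B).heytingEval v q = a ⊔ B.heytingEval v q := by
        apply le_antisymm
        · calc (imp A B).heytingEval v q
              = (A.heytingEval v q ⊔ a) ⊓ (A.heytingEval v q ⇨ B.heytingEval v q) := by
                rw [ha.sup_eq_top, top_inf_eq]; rfl
            _ ≤ a ⊔ B.heytingEval v q := by
                rw [inf_sup_right, inf_himp]
                exact sup_le (inf_le_right.trans le_sup_right) (inf_le_left.trans le_sup_left)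
        · refine sup_le (le_himp_iff.2 ?_) le_himp
          rw [inf_comm, ha.inf_eq_bot]
          exact bot_le
      rw [this]
      exact IsComplemented.sup ⟨_, ha.symm⟩ hB
    | neg A ih =>
      obtain ⟨a, ha⟩ := ih hA
      exact ⟨_, by simpa only [heytingEval, ha.compl_eq] using ha.symm⟩
    | pred | all | ex => exact hA.elim
  obtain ⟨a, ha⟩ := key
  rw [ha.compl_eq, ha.sup_eq_top]

end Formula

section

variable {H : Type*} [HeytingAlgebra H]

/-- The meet of the values of the formulas of an antecedent. -/
def heytingEvalList (v q : ℕ → H) : List Formula → H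
  | [] => ⊤
  | A :: Γ => A.heytingEval v q ⊓ heytingEvalList v q Γ

/-- The value of a succedent, which is `⊥` when the succedent is empty. -/
def heytingEvalOpt (v q : ℕ → H) : Option Formula → H
  | none => ⊥
  | some A => A.heytingEval v q

theorem heytingEvalList_append (v q : ℕ → H) (Γ Δ : List Formula) :
    heytingEvalList v q (Γ ++ Δ) = heytingEvalList v q Γ ⊓ heytingEvalList v q Δ := by
  induction Γ with
  | nil => simp [heytingEvalList]
  | cons A Γ ih => simp [heytingEvalList, ih, inf_assoc]

theorem LJPlus.heytingEvalList_le {v : ℕ → H} (q : ℕ → H) (hv : ∀ n, v n ⊔ (v n)ᶜ = ⊤)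
    {s : Sequent} (h : LJPlus s) : heytingEvalList v q s.1 ≤ heytingEvalOpt v q s.2 := by
  induction h with
  | step hr _ ih =>
    cases hr <;>
      simp only [List.mem_cons, List.not_mem_nil, or_false, forall_eq_or_imp, forall_eq,
        heytingEvalList, heytingEvalOpt, heytingEvalList_append, Formula.heytingEval,
        Formula.heytingEval_rename] at ih ⊢
    case ax | topR | botL => simp
    case thinL => exact inf_le_right.trans ih
    case thinR => exact ih.trans bot_le
    case contr => simpa [← inf_assoc] using ih
    case exch => rwa [inf_left_comm (Formula.heytingEval v q _)]
    case cut' => exact (inf_le_inf_right _ ih.1).trans ih.2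
    case andR => exact le_inf ih.1 ih.2
    case andL1 => exact (inf_le_inf_right _ inf_le_left).trans ih
    case andL2 => exact (inf_le_inf_right _ inf_le_right).trans ih
    case orL => rw [inf_sup_right]; exact sup_le ih.1 ih.2
    case orR1 => exact ih.trans le_sup_left
    case orR2 => exact ih.trans le_sup_right
    case negR => exact le_compl_iff_disjoint_left.2 (disjoint_iff_inf_le.2 ih)
    case negL => exact (inf_le_inf_left _ ih).trans (compl_inf_self _).le
    case impR => rwa [le_himp_iff']
    case impL =>
      rw [← inf_assoc]
      refine (inf_le_inf_right _ ?_).trans ih.2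
      exact (inf_le_inf_left _ ih.1).trans himp_inf_le
    case allR | allL | exR | exL => exact ih
    case neut' Γ Λ N hN _ =>
      rw [← top_inf_eq (heytingEvalList v q Γ), ← hN.heytingEval_sup_compl q hv, inf_sup_right]
      exact sup_le ih.1 ih.2
    case lemAx h _ => exact h.elim

end

/-- for a unary predicate symbol P, ∃x P(x) ∨ ¬∃x P(x) is not
derivable in LJ+, although it is derivable in LK. -/
theorem lem_for_existential_not_in_ljplus (P x : ℕ) :
    ¬ LJPlusThm ((Formula.ex x (Formula.pred P x [])).or
        (Formula.ex x (Formula.pred P x [])).neg) ∧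
    LKThm ((Formula.ex x (Formula.pred P x [])).or
        (Formula.ex x (Formula.pred P x [])).neg) := by
  refine ⟨fun h => ?_, .step (.lemAx _ trivial) (by simp)⟩
  have hle := LJPlus.heytingEvalList_le (H := Fin 3) (v := fun _ => ⊥) (fun _ => 1)
    (by simp) h
  simp only [heytingEvalList, heytingEvalOpt, Formula.heytingEval] at hle
  revert hle
  decide
end
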